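/- For every natural number k ≥ 2 and every real number λ > 1 with λ^(2k-1) - λ^k - λ^(k-1) - 1 = 0, the minimal polynomial of λ over ℚ equals x^(2k-1) - x^k - x^(k-1) - 1. -/

import Mathlib

open Polynomial

/-- The polynomial `u + v X ^ a + w X ^ b + z X ^ n`. -/
noncomputable def quadrinomial (a b n : ℕ) (u v w z : ℤ) : ℤ[X] :=
  C u + C v * X ^ a + C w * X ^ b + C z * X ^ n

namespace quadrinomial

variable {a b n : ℕ} {u v w z : ℤ}

theorem coeff_eq (i : ℕ) : (quadrinomial a b n u v w z).coeff i =
    (if i = 0 then u else 0) + (if i = a then v else 0) + (if i = b then w else 0) +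
      (if i = n then z else 0) := by
  simp only [quadrinomial, coeff_add, coeff_C_mul, coeff_X_pow, coeff_C, mul_ite, mul_one, mul_zero]

theorem neg_eq : -quadrinomial a b n u v w z = quadrinomial a b n (-u) (-v) (-w) (-z) := by
  simp only [quadrinomial, C_neg]
  ring

theorem natDegree_eq (hab : a < b) (hbn : b < n) (hz : z ≠ 0) :
    (quadrinomial a b n u v w z).natDegree = n := by
  refine le_antisymm (natDegree_le_iff_coeff_eq_zero.mpr fun i hi => ?_)
    (le_natDegree_of_ne_zero ?_)
  · rw [coeff_eq]
    grind
  · rw [coeff_eq]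
    grind

theorem natTrailingDegree_eq (ha : 0 < a) (hab : a < b) (hbn : b < n) (hu : u ≠ 0) :
    (quadrinomial a b n u v w z).natTrailingDegree = 0 := by
  refine natTrailingDegree_eq_zero.mpr (Or.inr ?_)
  rw [coeff_eq]
  grind

theorem mirror_eq (ha : 0 < a) (hab : a < b) (hbn : b < n) (hu : u ≠ 0) (hz : z ≠ 0) :
    (quadrinomial a b n u v w z).mirror = quadrinomial (n - b) (n - a) n z w v u := by
  ext i
  rw [coeff_mirror, natDegree_eq hab hbn hz, natTrailingDegree_eq ha hab hbn hu, coeff_eq, coeff_eq,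
    add_zero]
  rcases le_or_gt i n with hi | hi
  · rw [revAt_le hi]
    grind
  · rw [revAt_eq_self_of_lt hi]
    grind

theorem coeff_mul_reverse (i : ℕ) :
    (quadrinomial a b n u v w z * quadrinomial (n - b) (n - a) n z w v u).coeff i =
      (if i = 0 then u * z else 0) + (if i = n - b then u * w else 0) +
      (if i = n - a then u * v else 0) + (if i = n then u * u else 0) +
      ((if i = a then v * z else 0) + (if i = a + (n - b) then v * w else 0) +
      (if i = a + (n - a) then v * v else 0) + (if i = a + n then v * u else 0)) +
      ((if i = b then w * z else 0) + (if i = b + (n - b) then w * w else 0) +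
      (if i = b + (n - a) then w * v else 0) + (if i = b + n then w * u else 0)) +
      ((if i = n then z * z else 0) + (if i = n + (n - b) then z * w else 0) +
      (if i = n + (n - a) then z * v else 0) + (if i = n + n then z * u else 0)) := by
  have h : quadrinomial a b n u v w z * quadrinomial (n - b) (n - a) n z w v u =
      C (u * z) * X ^ 0 + C (u * w) * X ^ (n - b) + C (u * v) * X ^ (n - a) + C (u * u) * X ^ n +
      (C (v * z) * X ^ a + C (v * w) * X ^ (a + (n - b)) + C (v * v) * X ^ (a + (n - a)) +
        C (v * u) * X ^ (a + n)) +
      (C (w * z) * X ^ b + C (w * w) * X ^ (b + (n - b)) + C (w * v) * X ^ (b + (n - a)) +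
        C (w * u) * X ^ (b + n)) +
      (C (z * z) * X ^ n + C (z * w) * X ^ (n + (n - b)) + C (z * v) * X ^ (n + (n - a)) +
        C (z * u) * X ^ (n + n)) := by
    simp only [quadrinomial, C_mul, pow_add, pow_zero]
    ring
  rw [h]
  simp only [coeff_add, coeff_C_mul, coeff_X_pow, mul_ite, mul_one, mul_zero]

theorem coeff_mul_reverse_middle (ha : 0 < a) (hab : a < b) (hbn : b < n) :
    (quadrinomial a b n u v w z * quadrinomial (n - b) (n - a) n z w v u).coeff n =
      u ^ 2 + v ^ 2 + w ^ 2 + z ^ 2 := by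
  rw [coeff_mul_reverse, if_neg (by omega), if_neg (by omega), if_neg (by omega), if_pos rfl,
    if_neg (by omega), if_neg (by omega), if_pos (by omega), if_neg (by omega), if_neg (by omega),
    if_pos (by omega), if_neg (by omega), if_neg (by omega), if_pos rfl, if_neg (by omega),
    if_neg (by omega), if_neg (by omega)]
  ring

theorem coeff_mul_reverse_upper (ha : 0 < a) (hab : a < b) (hbn : b < n) {d : ℕ} (hd : 0 < d) :
    (quadrinomial a b n u v w z * quadrinomial (n - b) (n - a) n z w v u).coeff (n + d) =
      (if d = a then u * v else 0) + (if d = b then u * w else 0) + (if d = n then u * z else 0) +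
      (if d = b - a then v * w else 0) + (if d = n - a then v * z else 0) +
      (if d = n - b then w * z else 0) := by
  have h1 : n + d = a + n ↔ d = a := by omega
  have h2 : n + d = b + n ↔ d = b := by omega
  have h3 : n + d = b + (n - a) ↔ d = b - a := by omega
  rw [coeff_mul_reverse, if_neg (by omega), if_neg (by omega), if_neg (by omega),
    if_neg (by omega), if_neg (by omega), if_neg (by omega), if_neg (by omega)]
  rw [if_neg (show n + d ≠ b by omega), if_neg (show n + d ≠ b + (n - b) by omega),
    if_neg (show n + d ≠ n by omega)]
  simp only [h1, h2, h3, Nat.add_left_cancel_iff, mul_comm v u, mul_comm w u, mul_comm w v,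
    mul_comm z]
  ring

theorem eval_one : (quadrinomial a b n u v w z).eval 1 = u + v + w + z := by
  simp [quadrinomial]

end quadrinomial

/-- If a sum of integer squares equals `2`, exactly two of the terms are nonzero, and their
squares are `1`. -/
theorem Finset.exists_pair_of_sum_sq_eq_two {s : Finset ℕ} {c : ℕ → ℤ}
    (h : ∑ i ∈ s, c i ^ 2 = 2) :
    ∃ a ∈ s, ∃ b ∈ s, a < b ∧ c a ^ 2 = 1 ∧ c b ^ 2 = 1 ∧
      ∀ i ∈ s, i ≠ a → i ≠ b → c i = 0 := by
  have hle : ∀ i ∈ s, c i ^ 2 ≤ 2 := fun i hi =>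
    h ▸ Finset.single_le_sum (f := fun i => c i ^ 2) (fun _ _ => sq_nonneg _) hi
  have hsq : ∀ i ∈ s, c i ^ 2 = if c i ≠ 0 then 1 else 0 := by
    intro i hi
    have h1 := hle i hi
    have h2 : c i < 2 := by nlinarith
    have h3 : -2 < c i := by nlinarith
    generalize c i = x at *
    interval_cases x <;> simp
  rw [Finset.sum_congr rfl hsq, Finset.sum_boole] at h
  have hcard : (s.filter fun i => c i ≠ 0).card = 2 := by exact_mod_cast h
  obtain ⟨a, b, hab, hs⟩ := Finset.card_eq_two.mp hcard
  have hmem : ∀ i, i ∈ s ∧ c i ≠ 0 ↔ i = a ∨ i = b := by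
    intro i
    rw [← Finset.mem_filter (p := fun i => c i ≠ 0), hs]
    simp
  have ha := (hmem a).mpr (Or.inl rfl)
  have hb := (hmem b).mpr (Or.inr rfl)
  have ha' := hsq a ha.1
  have hb' := hsq b hb.1
  rw [if_pos ha.2] at ha'
  rw [if_pos hb.2] at hb'
  rcases lt_or_gt_of_ne hab with hlt | hlt
  · refine ⟨a, ha.1, b, hb.1, hlt, ha', hb', fun i hi h1 h2 => ?_⟩
    by_contra h0
    exact ((hmem i).mp ⟨hi, h0⟩).elim h1 h2
  · refine ⟨b, hb.1, a, ha.1, hlt, hb', ha', fun i hi h1 h2 => ?_⟩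
    by_contra h0
    exact ((hmem i).mp ⟨hi, h0⟩).elim h2 h1

/-- A polynomial whose product with its mirror is that of a unit quadrinomial with nonzero
constant term is itself such a quadrinomial. -/
theorem eq_quadrinomial_of_mul_mirror_eq {a b n : ℕ} (ha : 0 < a) (hab : a < b) (hbn : b < n)
    {u v w z : ℤ} (hu : u ^ 2 = 1) (hv : v ^ 2 = 1) (hw : w ^ 2 = 1) (hz : z ^ 2 = 1) {q : ℤ[X]}
    (h : quadrinomial a b n u v w z * (quadrinomial a b n u v w z).mirror = q * q.mirror) :
    ∃ a' b' u' v' w' z', 0 < a' ∧ a' < b' ∧ b' < n ∧ u' ^ 2 = 1 ∧ v' ^ 2 = 1 ∧ w' ^ 2 = 1 ∧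
      z' ^ 2 = 1 ∧ q = quadrinomial a' b' n u' v' w' z' := by
  have hu0 : u ≠ 0 := by rintro rfl; simp at hu
  have hz0 : z ≠ 0 := by rintro rfl; simp at hz
  have hdeg := congr_arg natDegree h
  have htr := congr_arg natTrailingDegree h
  rw [natDegree_mul_mirror, natDegree_mul_mirror, quadrinomial.natDegree_eq hab hbn hz0] at hdeg
  rw [natTrailingDegree_mul_mirror, natTrailingDegree_mul_mirror,
    quadrinomial.natTrailingDegree_eq ha hab hbn hu0] at htr
  have hqn : q.natDegree = n := by omega
  have hqt : q.natTrailingDegree = 0 := by omega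
  have hlead := congr_arg leadingCoeff h
  rw [leadingCoeff_mul, leadingCoeff_mul, mirror_leadingCoeff, mirror_leadingCoeff] at hlead
  simp only [leadingCoeff, trailingCoeff, hqn, hqt, quadrinomial.natDegree_eq hab hbn hz0,
    quadrinomial.natTrailingDegree_eq ha hab hbn hu0] at hlead
  have hsum := congr_arg (coeff · n) h
  have hmid := q.coeff_mul_mirror
  rw [hqn, hqt, add_zero, sum_over_range' _ (fun _ => by simp) (n + 1) (by omega)] at hmid
  simp only [hmid, quadrinomial.mirror_eq ha hab hbn hu0 hz0,
    quadrinomial.coeff_mul_reverse_middle ha hab hbn, hu, hv, hw, hz] at hsum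
  have hlead' : z * u = q.coeff n * q.coeff 0 := by
    rw [← hlead, quadrinomial.coeff_eq, quadrinomial.coeff_eq]
    grind
  have hunit : IsUnit (q.coeff n * q.coeff 0) := by
    rw [← hlead']
    exact (IsUnit.of_pow_eq_one hz two_ne_zero).mul (IsUnit.of_pow_eq_one hu two_ne_zero)
  have hqn1 := Int.isUnit_sq (isUnit_of_mul_isUnit_left hunit)
  have hq01 := Int.isUnit_sq (isUnit_of_mul_isUnit_right hunit)
  have hinner : ∑ i ∈ Finset.Ioo 0 n, q.coeff i ^ 2 = 2 := by
    have hr : Finset.range (n + 1) = insert 0 (insert n (Finset.Ioo 0 n)) := by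
      ext i
      simp only [Finset.mem_range, Finset.mem_insert, Finset.mem_Ioo]
      omega
    rw [hr, Finset.sum_insert (by simp; omega), Finset.sum_insert (by simp), hqn1, hq01] at hsum
    linarith
  obtain ⟨a', ha', b', hb', hab', hva, hvb, hrest⟩ := Finset.exists_pair_of_sum_sq_eq_two hinner
  rw [Finset.mem_Ioo] at ha' hb'
  refine ⟨a', b', q.coeff 0, q.coeff a', q.coeff b', q.coeff n, ha'.1, hab', hb'.2, hq01, hva, hvb,
    hqn1, ?_⟩
  ext i
  rw [quadrinomial.coeff_eq]
  have hbig : n < i → q.coeff i = 0 := fun hi => coeff_eq_zero_of_natDegree_lt (hqn ▸ hi)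
  have hmem := hrest i
  rw [Finset.mem_Ioo] at hmem
  grind

/-- The Liechti–Strenner polynomial `x ^ (2 k - 1) - x ^ k - x ^ (k - 1) - 1` over `ℤ`. -/
noncomputable def liechtiStrenner (k : ℕ) : ℤ[X] :=
  quadrinomial (k - 1) k (2 * k - 1) (-1) (-1) (-1) 1

namespace liechtiStrenner

variable {k : ℕ}

theorem mirror_eq (hk : 2 ≤ k) :
    (liechtiStrenner k).mirror = quadrinomial (k - 1) k (2 * k - 1) 1 (-1) (-1) (-1) := by
  rw [liechtiStrenner, quadrinomial.mirror_eq (by omega) (by omega) (by omega) (by simp) (by simp)]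
  congr 1 <;> omega

theorem monic (hk : 2 ≤ k) : (liechtiStrenner k).Monic := by
  rw [Monic, leadingCoeff, liechtiStrenner,
    quadrinomial.natDegree_eq (by omega) (by omega) one_ne_zero, quadrinomial.coeff_eq]
  grind

theorem coeff_mul_mirror_upper (hk : 2 ≤ k) {d : ℕ} (hd : 0 < d) :
    (liechtiStrenner k * (liechtiStrenner k).mirror).coeff (2 * k - 1 + d) =
      (if d = 2 * k - 1 then -1 else 0) + (if d = 1 then 1 else 0) := by
  rw [liechtiStrenner, quadrinomial.mirror_eq (by omega) (by omega) (by omega) (by simp) (by simp),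
    quadrinomial.coeff_mul_reverse_upper (by omega) (by omega) (by omega) hd,
    show k - (k - 1) = 1 by omega, show 2 * k - 1 - (k - 1) = k by omega,
    show 2 * k - 1 - k = k - 1 by omega]
  split_ifs <;> omega

theorem eq_or_eq_of_mul_mirror_eq (hk : 2 ≤ k) {q : ℤ[X]}
    (h : liechtiStrenner k * (liechtiStrenner k).mirror = q * q.mirror) :
    q = liechtiStrenner k ∨ q = -liechtiStrenner k ∨ q = (liechtiStrenner k).mirror ∨
      q = -(liechtiStrenner k).mirror := by
  obtain ⟨a, b, u, v, w, z, ha, hab, hbn, hu, hv, hw, hz, rfl⟩ :=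
    eq_quadrinomial_of_mul_mirror_eq (by omega) (by omega) (by omega) (by norm_num) (by norm_num)
      (by norm_num) (by norm_num) h
  have hu0 : u ≠ 0 := by rintro rfl; simp at hu
  have hz0 : z ≠ 0 := by rintro rfl; simp at hz
  have heval := congr_arg (eval 1) h
  rw [eval_mul, eval_mul, mirror_eval_one, mirror_eval_one, liechtiStrenner, quadrinomial.eval_one,
    quadrinomial.eval_one] at heval
  have hcoeff : ∀ d, 0 < d → (if d = 2 * k - 1 then -1 else 0) + (if d = 1 then 1 else 0) =
      (if d = a then u * v else 0) + (if d = b then u * w else 0) +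
      (if d = 2 * k - 1 then u * z else 0) + (if d = b - a then v * w else 0) +
      (if d = 2 * k - 1 - a then v * z else 0) + (if d = 2 * k - 1 - b then w * z else 0) := by
    intro d hd
    rw [← quadrinomial.coeff_mul_reverse_upper ha hab hbn hd,
      ← quadrinomial.mirror_eq ha hab hbn hu0 hz0, ← h, coeff_mul_mirror_upper hk hd]
  have huz : u * z = -1 := by
    have := hcoeff (2 * k - 1) (by omega)
    rw [if_pos rfl, if_neg (by omega), if_neg (by omega), if_neg (by omega), if_pos rfl,
      if_neg (by omega), if_neg (by omega), if_neg (by omega)] at this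
    linarith
  have hsum : a + b = 2 * k - 1 := by
    by_contra hne
    have := hcoeff (2 * k - 1 - a) (by omega)
    rw [if_neg (by omega), if_neg (by omega), if_neg (by omega), if_neg (by omega),
      if_neg (by omega), if_neg (by omega), if_pos rfl, if_neg (by omega)] at this
    have hvz : v * z = 0 := by linarith
    rcases mul_eq_zero.mp hvz with rfl | rfl
    · simp at hv
    · exact hz0 rfl
  have hzu : z = -u := by linear_combination u * huz - z * hu
  have hvw : v = w := by
    subst hzu
    have h1 : v * w = 1 := by linarith
    linear_combination w * h1 - v * hw
  subst hzu hvw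
  have hba : b = a + 1 := by
    have := hcoeff 1 one_pos
    by_contra hne
    grind
  obtain rfl : a = k - 1 := by omega
  obtain rfl : b = k := by omega
  rw [mirror_eq hk, liechtiStrenner]
  rcases sq_eq_one_iff.mp hu with rfl | rfl <;>
    rcases sq_eq_one_iff.mp hv with rfl | rfl <;>
    simp [quadrinomial.neg_eq]

theorem isRelPrime_mirror (hk : 2 ≤ k) :
    IsRelPrime (liechtiStrenner k) (liechtiStrenner k).mirror := by
  intro g hg hg'
  suffices ¬0 < g.natDegree by
    obtain ⟨r, hr⟩ := hg
    have hlead := monic hk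
    rw [Monic, hr, leadingCoeff_mul] at hlead
    have hunit := IsUnit.of_mul_eq_one _ hlead
    rw [not_lt, Nat.le_zero] at this
    rwa [eq_C_of_natDegree_eq_zero this, isUnit_C, ← this]
  intro hpos
  rw [natDegree_pos_iff_degree_pos,
    ← degree_map_eq_of_injective (algebraMap ℤ ℂ).injective_int] at hpos
  obtain ⟨x, hx⟩ := Complex.exists_root hpos
  rw [IsRoot, eval_map_algebraMap] at hx
  have h1 := aeval_eq_zero_of_dvd_aeval_eq_zero hg hx
  have h2 := aeval_eq_zero_of_dvd_aeval_eq_zero hg' hx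
  rw [mirror_eq hk] at h2
  simp only [liechtiStrenner, quadrinomial, map_add, map_mul, map_neg, map_one, map_pow, aeval_X]
    at h1 h2
  obtain ⟨m, rfl⟩ : ∃ m, k = m + 1 := ⟨k - 1, by omega⟩
  have hodd : Odd (2 * (m + 1) - 1) := ⟨m, by omega⟩
  have hone : x ^ (2 * (m + 1) - 1) = 1 := by linear_combination (h1 - h2) / 2
  have hx0 : x ≠ 0 := by
    rintro rfl
    rw [zero_pow (by omega)] at hone
    exact zero_ne_one hone
  have hprod : x ^ m * (x + 1) = 0 := by
    rw [Nat.add_sub_cancel] at h1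
    linear_combination hone - h1
  have hxneg : x = -1 :=
    eq_neg_of_add_eq_zero_left ((mul_eq_zero.mp hprod).resolve_left (pow_ne_zero _ hx0))
  rw [hxneg, hodd.neg_one_pow] at hone
  norm_num at hone

theorem irreducible (hk : 2 ≤ k) : Irreducible (liechtiStrenner k) := by
  refine irreducible_of_mirror (fun hunit => ?_) (fun q hq => eq_or_eq_of_mul_mirror_eq hk hq)
    (isRelPrime_mirror hk)
  have := natDegree_eq_zero_of_isUnit hunit
  rw [liechtiStrenner, quadrinomial.natDegree_eq (by omega) (by omega) one_ne_zero] at this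
  omega

theorem map_eq (k : ℕ) : (liechtiStrenner k).map (algebraMap ℤ ℚ) =
    X ^ (2 * k - 1) - X ^ k - X ^ (k - 1) - 1 := by
  simp only [liechtiStrenner, quadrinomial, Polynomial.map_add, Polynomial.map_mul,
    Polynomial.map_pow, map_X, C_neg, C_1, Polynomial.map_neg, Polynomial.map_one]
  ring

end liechtiStrenner

/-- For every `k ≥ 2` and every real `λ > 1` which is a root of the
Liechti–Strenner polynomial, the minimal polynomial of `λ` over `ℚ` equals
`x^(2k-1) - x^k - x^(k-1) - 1`. -/
theorem minpoly_eq_liechti_strenner (k : ℕ) (hk : 2 ≤ k) (lam : ℝ)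
    (hlam : 1 < lam)
    (h : lam ^ (2 * k - 1) - lam ^ k - lam ^ (k - 1) - 1 = 0) :
    minpoly ℚ lam = X ^ (2 * k - 1) - X ^ k - X ^ (k - 1) - 1 := by
  rw [← liechtiStrenner.map_eq]
  have hmonic := liechtiStrenner.monic hk
  refine (minpoly.eq_of_irreducible_of_monic
    (hmonic.irreducible_iff_irreducible_map_fraction_map.mp (liechtiStrenner.irreducible hk)) ?_
    (hmonic.map _)).symm
  rw [liechtiStrenner.map_eq]
  simpa using h
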